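/- arXiv:1105.6224 — 2 statements merged into one kernel-verified Lean document; each statement's English description precedes it below -/
import Mathlib

section
/- Let q be a prime power, fix integers Δ1 ≥ 1 and 1 ≤ k1 ≤ Δ1, and fix a rational R ∈ (0,1) with k1/Δ1 ≤ (1+R)/2. Then for every ε > 0 there exists b0 such that for every b1 ≥ b0 and every code C ⊆ F_q^n (n = b1Δ1) having the expander-code structure with parameters Δ1, k1, b1 and satisfying dim(C) = R·n, the minimum distance satisfies d(C)/n ≤ ((q−1)/q)·((1−R)/(1+R)) + ε. -/
theorem aux_coord {F ι : Type} [Field F] [Fintype F] [DecidableEq F] [Fintype ι]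
    (V : Submodule F (ι → F)) [Fintype V] (e : ι) :
    Fintype.card F * (Finset.univ.filter (fun c : V => c.1 e ≠ 0)).card + Fintype.card V
      ≤ Fintype.card F * Fintype.card V := by
  classical
  let f : V →ₗ[F] F := (LinearMap.proj e).comp V.subtype
  have h1 : Nat.card V = Nat.card (LinearMap.ker f) * Nat.card (V ⧸ LinearMap.ker f) :=
    Submodule.card_eq_card_quotient_mul_card _ |>.trans (by ring)
  have h2 : Nat.card (V ⧸ LinearMap.ker f) ≤ Fintype.card F := by
    rw [Nat.card_congr f.quotKerEquivRange.toEquiv, ← Nat.card_eq_fintype_card]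
    exact Nat.card_le_card_of_injective _ (Subtype.val_injective)
  have h3 : Nat.card (LinearMap.ker f) = (Finset.univ.filter (fun c : V => c.1 e = 0)).card := by
    rw [← Fintype.card_subtype, ← Nat.card_eq_fintype_card]
    apply Nat.card_congr
    exact Equiv.subtypeEquivRight (fun c => by simp [f])
  have h4 : (Finset.univ.filter (fun c : V => c.1 e = 0)).card +
      (Finset.univ.filter (fun c : V => c.1 e ≠ 0)).card = Fintype.card V := by
    rw [Finset.card_filter_add_card_filter_not]; rfl
  rw [Nat.card_eq_fintype_card, h3] at h1
  generalize (Finset.univ.filter (fun c : V => c.1 e = 0)).card = a at *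
  generalize (Finset.univ.filter (fun c : V => c.1 e ≠ 0)).card = b at *
  have : a * Nat.card (V ⧸ LinearMap.ker f) ≤ a * Fintype.card F := Nat.mul_le_mul_left _ h2
  nlinarith

theorem aux_plotkin {F ι : Type} [Field F] [Fintype F] [DecidableEq F] [Fintype ι] [DecidableEq ι]
    (V : Submodule F (ι → F)) (S : Finset ι) (hS : ∀ c ∈ V, ∀ e, e ∉ S → c e = 0)
    (hV : V ≠ ⊥) :
    ∃ c ∈ V, c ≠ 0 ∧ (hammingNorm c : ℝ) ≤
      ((Fintype.card F : ℝ) - 1) / (Fintype.card F : ℝ) * S.card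
        + (Fintype.card ι : ℝ) / (Nat.card V : ℝ) := by
  classical
  have hfin : Fintype V := Fintype.ofFinite V
  obtain ⟨x, hx, hx0⟩ := Submodule.exists_mem_ne_zero_of_ne_bot hV
  obtain ⟨c, hc, hmin⟩ := Finset.exists_min_image (Finset.univ.filter (fun c : V => c ≠ 0))
    (fun c => hammingNorm c.1) ⟨⟨x, hx⟩, by simp [hx0]⟩
  have hc0 : c ≠ 0 := by simpa using hc
  refine ⟨c.1, c.2, by simpa using hc0, ?_⟩
  have hsum : ∑ v : V, hammingNorm v.1
      = ∑ e ∈ S, (Finset.univ.filter (fun c : V => c.1 e ≠ 0)).card := by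
    have : ∀ v : V, hammingNorm v.1 = ∑ e ∈ S, if v.1 e ≠ 0 then 1 else 0 := by
      intro v
      rw [← Finset.card_filter, hammingNorm]
      congr 1
      ext e
      simp only [Finset.mem_filter, Finset.mem_univ, true_and]
      constructor
      · intro h
        refine ⟨?_, h⟩
        by_contra h'
        exact h (hS _ v.2 _ h')
      · exact fun h => h.2
    simp_rw [this]
    rw [Finset.sum_comm]
    simp_rw [Finset.card_filter]
  have hub : Fintype.card F * ∑ v : V, hammingNorm v.1 + S.card * Fintype.card V
      ≤ Fintype.card F * (S.card * Fintype.card V) := by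
    rw [hsum, Finset.mul_sum, ← smul_eq_mul S.card, ← Finset.sum_const, ← Finset.sum_add_distrib,
      Finset.mul_sum]
    exact Finset.sum_le_sum fun e _ => aux_coord V e
  have hlb : Fintype.card V * hammingNorm c.1 ≤ ∑ v : V, hammingNorm v.1 + hammingNorm c.1 := by
    have h1 : ∑ v : V, hammingNorm c.1 ≤
        ∑ v : V, (hammingNorm v.1 + if v = 0 then hammingNorm c.1 else 0) := by
      apply Finset.sum_le_sum
      intro v _
      by_cases hv : v = 0
      · simp [hv]
      · simpa [hv] using hmin v (by simp [hv])
    rw [Finset.sum_add_distrib] at h1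
    simpa using h1
  have hle : hammingNorm c.1 ≤ Fintype.card ι := hammingNorm_le_card_fintype
  rw [Nat.card_eq_fintype_card]
  have hq : (0:ℝ) < Fintype.card F := by exact_mod_cast Fintype.card_pos
  have hM : (0:ℝ) < Fintype.card V := by exact_mod_cast Fintype.card_pos
  have hub' : (Fintype.card F : ℝ) * (∑ v : V, hammingNorm v.1 : ℕ) + S.card * Fintype.card V
      ≤ Fintype.card F * (S.card * Fintype.card V) := by exact_mod_cast hub
  have hlb' : (Fintype.card V : ℝ) * hammingNorm c.1 ≤ (∑ v : V, hammingNorm v.1 : ℕ) + hammingNorm c.1 := by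
    exact_mod_cast hlb
  have hle' : (hammingNorm c.1 : ℝ) ≤ Fintype.card ι := by exact_mod_cast hle
  generalize ((∑ v : V, hammingNorm v.1 : ℕ) : ℝ) = T at *
  have hT : T ≤ ((Fintype.card F : ℝ) - 1) / (Fintype.card F : ℝ) * S.card * Fintype.card V := by
    rw [div_mul_eq_mul_div, div_mul_eq_mul_div, le_div_iff₀ hq]
    linarith
  have : (hammingNorm c.1 : ℝ) ≤ (((Fintype.card F : ℝ) - 1) / (Fintype.card F : ℝ) * S.card * Fintype.card V + Fintype.card ι) / Fintype.card V := by
    rw [le_div_iff₀ hM]; linarith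
  rwa [add_div, mul_div_cancel_right₀ _ hM.ne'] at this

theorem aux_dim {F : Type} [Field F] (b1 Δ1 k1 s : ℕ) (hk1' : k1 ≤ Δ1)
    (H : Fin b1 → Matrix (Fin (Δ1 - k1)) (Fin Δ1) F) (hH : ∀ i, (H i).rank = Δ1 - k1)
    (C : Submodule F (Fin b1 × Fin Δ1 → F))
    (hC : ∀ x ∈ C, ∀ i, (H i).mulVec (fun j => x (i, j)) = 0) :
    ∃ V : Submodule F (Fin b1 × Fin Δ1 → F), V ≤ C ∧
      (∀ c ∈ V, ∀ e : Fin b1 × Fin Δ1, e.1.val < s → c e = 0) ∧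
      Module.finrank F C ≤ Module.finrank F V + s * k1 := by
  classical
  let f : C →ₗ[F] ((i : {i : Fin b1 // i.val < s}) → LinearMap.ker (H i.1).mulVecLin) :=
    LinearMap.pi fun i => LinearMap.codRestrict _
      ((LinearMap.funLeft F F (fun j => (i.1, j))).comp C.subtype)
      (fun c => by
        have := hC c.1 c.2 i.1
        simpa [LinearMap.funLeft, Function.comp_def] using this)
  refine ⟨(LinearMap.ker f).map C.subtype, Submodule.map_subtype_le _ _, ?_, ?_⟩
  · rintro c hc ⟨i, j⟩ hi
    obtain ⟨x, hx, rfl⟩ := hc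
    have h1 : f x = 0 := hx
    have h2 := congrArg Subtype.val (congrFun h1 ⟨i, hi⟩)
    exact congrFun h2 j
  · rw [Submodule.finrank_map_subtype_eq]
    have h1 := f.finrank_range_add_finrank_ker
    have h2 := Submodule.finrank_le (LinearMap.range f)
    have h3 : ∀ i, Module.finrank F (LinearMap.ker (H i).mulVecLin) = k1 := by
      intro i
      have := (H i).mulVecLin.finrank_range_add_finrank_ker
      have h4 := hH i
      rw [Matrix.rank] at h4
      rw [h4] at this
      simp at this
      omega
    rw [Module.finrank_pi_fintype] at h2
    simp only [h3, Finset.sum_const, smul_eq_mul, Finset.card_univ] at h2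
    have h5 : Fintype.card {i : Fin b1 // i.val < s} ≤ s := by
      have := Fintype.card_le_of_injective
        (fun i : {i : Fin b1 // i.val < s} => (⟨i.1.val, i.2⟩ : Fin s))
        (fun a b hab => by
          simp only [Fin.mk.injEq] at hab
          exact Subtype.ext (Fin.ext hab))
      simpa using this
    have h6 := Nat.mul_le_mul_right k1 h5
    omega


/-- Let q be a prime power, fix integers Δ1 ≥ 1 and 1 ≤ k1 ≤ Δ1, and fix a
rational R ∈ (0,1) with k1/Δ1 ≤ (1+R)/2.  Then for every ε > 0 there exists b0 such that for
every b1 ≥ b0 and every code C ⊆ F_q^n (n = b1·Δ1) having the expander-code structure with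
parameters Δ1, k1, b1 and satisfying dim(C) = R·n, the minimum distance satisfies
d(C)/n ≤ ((q−1)/q)·((1−R)/(1+R)) + ε. -/
theorem statement_1 (q : ℕ) (hq : IsPrimePow q)
    (F : Type) [Field F] [Fintype F] [DecidableEq F] (hF : Fintype.card F = q)
    (Δ1 k1 : ℕ) (hΔ1 : 1 ≤ Δ1) (hk1 : 1 ≤ k1) (hk1' : k1 ≤ Δ1)
    (R : ℚ) (hR0 : 0 < R) (hR1 : R < 1) (hRk : (k1 : ℚ) / (Δ1 : ℚ) ≤ (1 + R) / 2)
    (ε : ℝ) (hε : 0 < ε) :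
    ∃ b0 : ℕ, ∀ b1 : ℕ, b0 ≤ b1 →
      ∀ H : Fin b1 → Matrix (Fin (Δ1 - k1)) (Fin Δ1) F,
        (∀ i, (H i).rank = Δ1 - k1) →
        ∀ (m : ℕ) (B : Matrix (Fin m) (Fin b1 × Fin Δ1) F)
          (C : Submodule F (Fin b1 × Fin Δ1 → F)),
          (∀ x, x ∈ C ↔ (∀ i, (H i).mulVec (fun j => x (i, j)) = 0) ∧ B.mulVec x = 0) →
          (Module.finrank F C : ℚ) = R * ((b1 * Δ1 : ℕ) : ℚ) →
          ∃ c ∈ C, c ≠ 0 ∧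
            (hammingNorm c : ℝ) / ((b1 * Δ1 : ℕ) : ℝ) ≤
              ((q : ℝ) - 1) / (q : ℝ) * ((1 - (R : ℝ)) / (1 + (R : ℝ))) + ε := by
  obtain ⟨K, hK⟩ := exists_nat_gt (2 / ε)
  have hR0' : (0:ℝ) < R := by exact_mod_cast hR0
  have hR1' : (R:ℝ) < 1 := by exact_mod_cast hR1
  have hKpos : (0:ℝ) < K := lt_trans (by positivity) hK
  have hKε : 1 / (K:ℝ) ≤ ε / 2 := by
    rw [div_lt_iff₀ hε] at hK
    rw [div_le_div_iff₀ hKpos (by norm_num)]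
    linarith
  obtain ⟨b0, hb0⟩ := exists_nat_gt ((K:ℝ) / R + 2 * (K + 1) / ε)
  refine ⟨b0, ?_⟩
  intro b1 hb1 H hH m B C hC hdim
  have hb1' : (b0:ℝ) ≤ b1 := by exact_mod_cast hb1
  have hp1 : 0 < (K:ℝ) / R := by positivity
  have hp2 : 0 < 2 * ((K:ℝ) + 1) / ε := by positivity
  have hbpos : (0:ℝ) < b1 := by linarith
  have hΔ : (1:ℝ) ≤ Δ1 := by exact_mod_cast hΔ1
  have hk : (1:ℝ) ≤ k1 := by exact_mod_cast hk1
  have hKb : (K:ℝ) ≤ R * b1 := by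
    have : (K:ℝ) / R ≤ b1 := by linarith
    rw [div_le_iff₀ hR0'] at this
    linarith
  have hKb2 : ((K:ℝ) + 1) / b1 ≤ ε / 2 := by
    have : 2 * ((K:ℝ) + 1) / ε ≤ b1 := by linarith
    rw [div_le_iff₀ hε] at this
    rw [div_le_div_iff₀ hbpos (by norm_num)]
    linarith
  have hdim' : (Module.finrank F C : ℝ) = R * (b1 * Δ1) := by
    have := congrArg (fun x : ℚ => (x : ℝ)) hdim
    push_cast at this
    exact this
  have hKd : K ≤ Module.finrank F C := by
    have : (K:ℝ) ≤ Module.finrank F C := by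
      rw [hdim']
      have : (R:ℝ) * b1 * 1 ≤ R * b1 * Δ1 := mul_le_mul_of_nonneg_left hΔ (by positivity)
      linarith
    exact_mod_cast this
  obtain ⟨s, hs⟩ : ∃ s, s = (Module.finrank F C - K) / k1 := ⟨_, rfl⟩
  have hs1 : s * k1 ≤ Module.finrank F C - K := by
    rw [hs]; exact Nat.div_mul_le_self _ _
  have hs2 : Module.finrank F C - K < (s + 1) * k1 := by
    rw [hs, mul_comm]; exact Nat.lt_mul_div_succ _ (by omega)
  obtain ⟨V, hVC, hV0, hVd⟩ := aux_dim b1 Δ1 k1 s hk1' H hH C (fun x hx => ((hC x).1 hx).1)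
  have hKV : K ≤ Module.finrank F V := by omega
  have hKpos' : 0 < K := by exact_mod_cast hKpos
  have hVne : V ≠ ⊥ := by
    rintro rfl
    simp at hKV
    omega
  obtain ⟨c, hcV, hc0, hcw⟩ := aux_plotkin V
    ((Finset.univ.filter (fun i : Fin b1 => ¬ i.val < s)) ×ˢ (Finset.univ : Finset (Fin Δ1)))
    (fun c hc e he => hV0 c hc e (by
      by_contra h
      exact he (by simpa using h))) hVne
  refine ⟨c, hVC hcV, hc0, ?_⟩
  have hsb : s ≤ b1 := by
    by_contra h
    apply hc0
    ext e
    exact hV0 c hcV e (lt_trans e.1.isLt (by omega))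
  have hcard : (Finset.univ.filter (fun i : Fin b1 => ¬ i.val < s)).card + s = b1 := by
    have h1 := Finset.card_filter_add_card_filter_not (s := (Finset.univ : Finset (Fin b1)))
      (fun i : Fin b1 => i.val < s)
    have h2 : (Finset.univ.filter (fun i : Fin b1 => i.val < s)).card = s := by
      rw [Fin.card_filter_val_lt]; omega
    rw [h2] at h1
    simp only [Finset.card_univ, Fintype.card_fin] at h1
    omega
  have hcard' : ((Finset.univ.filter (fun i : Fin b1 => ¬ i.val < s)).card : ℝ) = b1 - s := by
    have : ((Finset.univ.filter (fun i : Fin b1 => ¬ i.val < s)).card : ℝ) + s = b1 := by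
      exact_mod_cast hcard
    linarith
  have hM : (K:ℝ) ≤ Nat.card V := by
    have h1 : Nat.card V = Nat.card F ^ Module.finrank F V := Module.natCard_eq_pow_finrank
    have h2 : 2 ≤ Nat.card F := by
      rw [Nat.card_eq_fintype_card]; exact Fintype.one_lt_card
    have h3 : K < 2 ^ K := Nat.lt_two_pow_self
    have h4 : 2 ^ K ≤ Nat.card F ^ Module.finrank F V :=
      (Nat.pow_le_pow_right (by norm_num) hKV).trans (Nat.pow_le_pow_left h2 _)
    have : K ≤ Nat.card V := by rw [h1]; omega
    exact_mod_cast this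
  rw [hF, Finset.card_product, Nat.cast_mul, hcard'] at hcw
  simp only [Finset.card_univ, Fintype.card_prod, Fintype.card_fin] at hcw
  have hq1 : (1:ℝ) ≤ q := by exact_mod_cast hq.one_lt.le
  have ha0 : 0 ≤ ((q:ℝ) - 1) / q := div_nonneg (by linarith) (by linarith)
  have ha1 : ((q:ℝ) - 1) / q ≤ 1 := by
    rw [div_le_one (by linarith)]; linarith
  generalize ((q:ℝ) - 1) / q = a at *
  have hs2' : (R:ℝ) * (b1 * Δ1) < (s + 1) * k1 + K := by
    rw [← hdim']
    have : Module.finrank F C < (s + 1) * k1 + K := by omega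
    exact_mod_cast this
  have hRk' : (k1:ℝ) / Δ1 ≤ (1 + R) / 2 := by
    have := (Rat.cast_le (K := ℝ)).2 hRk
    push_cast at this
    exact this
  have hRk2 : 2 * (k1:ℝ) ≤ (1 + R) * Δ1 := by
    rw [div_le_div_iff₀ (by linarith) (by norm_num)] at hRk'
    linarith
  -- lower bound on s
  have hslow : 2 * (R:ℝ) / (1 + R) * b1 ≤ (s:ℝ) + (K + 1) := by
    have h1 : 2 * (R:ℝ) / (1 + R) * b1 * k1 ≤ R * (b1 * Δ1) := by
      have : 2 * (R:ℝ) / (1 + R) * b1 * k1 = (R * b1 / (1 + R)) * (2 * k1) := by ring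
      rw [this]
      have h := mul_le_mul_of_nonneg_left hRk2 (show 0 ≤ (R:ℝ) * b1 / (1 + R) by positivity)
      refine h.trans (le_of_eq ?_)
      field_simp
    have h2 : (K:ℝ) * 1 ≤ K * k1 := mul_le_mul_of_nonneg_left hk hKpos.le
    have h3 : 2 * (R:ℝ) / (1 + R) * b1 * k1 ≤ ((s:ℝ) + (K + 1)) * k1 := by nlinarith
    exact le_of_mul_le_mul_right h3 (by linarith)
  have ht : ((b1:ℝ) - s) / b1 ≤ (1 - R) / (1 + R) + ε / 2 := by
    have h1 : ((b1:ℝ) - s) ≤ (1 - R) / (1 + R) * b1 + (K + 1) := by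
      have : (1 - (R:ℝ)) / (1 + R) = 1 - 2 * R / (1 + R) := by field_simp; ring
      rw [this]; linarith
    have h2 : ((b1:ℝ) - s) / b1 ≤ ((1 - R) / (1 + R) * b1 + (K + 1)) / b1 := by gcongr
    rw [add_div, mul_div_cancel_right₀ _ hbpos.ne'] at h2
    linarith
  have hMinv : 1 / (Nat.card V : ℝ) ≤ ε / 2 :=
    (one_div_le_one_div_of_le hKpos hM).trans hKε
  have hfin : (hammingNorm c : ℝ) / ((b1 * Δ1 : ℕ) : ℝ)
      ≤ a * (((b1:ℝ) - s) / b1) + 1 / (Nat.card V : ℝ) := by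
    have hMp : (0:ℝ) < Nat.card V := by linarith
    push_cast at hcw ⊢
    rw [div_le_iff₀ (by positivity)]
    refine hcw.trans (le_of_eq ?_)
    field_simp
  have h1 := mul_le_mul_of_nonneg_left ht ha0
  have h2 : a * (ε / 2) ≤ 1 * (ε / 2) := mul_le_mul_of_nonneg_right ha1 (by linarith)
  rw [mul_add] at h1
  linarith
end

section
/- Let q be a prime power, let C0 = RS(Δ0,k0) be a Reed–Solomon code over F_q with weight enumerator g0(s) = Σ_{y∈C0} s^{wt(y)}, let b ≥ 1 and n = bΔ0, and consider the two-layer ensemble E1(Δ0,b) with base code C_b = C0^b. Then for every real s > 0 and every W with 0 ≤ W ≤ n, the ensemble-average number of weight-W codewords satisfies Ā(W) ≤ (g0(s)^b · s^{−W})² / ((q−1)^W · binom(n,W)). -/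
open Finset in
theorem aux_sphere {ι F : Type} [Fintype ι] [DecidableEq ι] [Field F] [Fintype F] [DecidableEq F]
    (W : ℕ) : (univ.filter (fun x : ι → F => hammingNorm x = W)).card
      = (Fintype.card ι).choose W * (Fintype.card F - 1) ^ W := by
  have h1 : ∀ x ∈ univ.filter (fun x : ι → F => hammingNorm x = W),
      (univ.filter (fun i => x i ≠ 0)) ∈ powersetCard W (univ : Finset ι) := by
    intro x hx
    simp only [mem_filter, mem_univ, true_and] at hx
    simp only [mem_powersetCard, subset_univ, true_and]
    exact hx
  rw [card_eq_sum_card_fiberwise h1]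
  rw [sum_congr rfl (g := fun _ => (Fintype.card F - 1) ^ W)]
  · simp [card_powersetCard]
  · intro A hA
    have hA' : A.card = W := (mem_powersetCard.1 hA).2
    have : ((univ.filter (fun x : ι → F => hammingNorm x = W)).filter
        (fun x => univ.filter (fun i => x i ≠ 0) = A))
        = Fintype.piFinset (fun i => if i ∈ A then univ.erase (0 : F) else {0}) := by
      ext x
      simp only [mem_filter, mem_univ, true_and, Fintype.mem_piFinset]
      constructor
      · rintro ⟨_, h⟩ i
        subst h
        by_cases hi : x i = 0 <;> simp [hi]
      · intro h
        have h2 : univ.filter (fun i => x i ≠ 0) = A := by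
          ext i
          have := h i
          by_cases hi : i ∈ A <;> simp [hi] at this ⊢ <;> exact this
        refine ⟨?_, h2⟩
        rw [← hA', ← h2]; rfl
    rw [this, Fintype.card_piFinset]
    have h3 : ∀ i, (if i ∈ A then univ.erase (0 : F) else {0}).card
        = if i ∈ A then (Fintype.card F - 1) else 1 := by
      intro i
      split_ifs <;> simp [card_erase_of_mem]
    simp only [h3]
    rw [Finset.prod_ite]
    simp [hA']

abbrev AuxT (ι F : Type) [Field F] := Equiv.Perm ι × {c : ι → F // ∀ j, c j ≠ 0}

def auxPhi {ι F : Type} [Field F] (t : AuxT ι F) (x : ι → F) : ι → F :=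
  fun j => t.2.1 j * x (t.1 j)

theorem auxPhi_inj {ι F : Type} [Field F] (t : AuxT ι F) : Function.Injective (auxPhi t) := by
  intro x y h
  funext j
  have := congrFun h (t.1.symm j)
  simp only [auxPhi, Equiv.apply_symm_apply] at this
  exact mul_left_cancel₀ (t.2.2 _) this

theorem auxPhi_wt {ι F : Type} [Fintype ι] [Field F] [DecidableEq F] (t : AuxT ι F) (x : ι → F) :
    hammingNorm (auxPhi t x) = hammingNorm x := by
  unfold hammingNorm auxPhi
  refine Finset.card_bij (fun j _ => t.1 j) ?_ ?_ ?_
  · intro a ha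
    simp only [Finset.mem_filter, Finset.mem_univ, true_and] at ha ⊢
    exact right_ne_zero_of_mul ha
  · intro a _ a' _ h
    exact t.1.injective h
  · intro a ha
    simp only [Finset.mem_filter, Finset.mem_univ, true_and] at ha
    refine ⟨t.1.symm a, ?_, by simp⟩
    simp only [Finset.mem_filter, Finset.mem_univ, true_and, Equiv.apply_symm_apply]
    exact mul_ne_zero (t.2.2 _) ha

theorem aux_trans {ι F : Type} [Fintype ι] [DecidableEq ι] [Field F] [DecidableEq F]
    (x y : ι → F) (h : hammingNorm x = hammingNorm y) : ∃ t : AuxT ι F, auxPhi t x = y := by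
  have hc : Fintype.card {i // y i ≠ 0} = Fintype.card {i // x i ≠ 0} := by
    rw [Fintype.card_subtype, Fintype.card_subtype]
    exact h.symm
  let e := Fintype.equivOfCardEq hc
  have h1 : ∀ j, y j ≠ 0 → x (e.extendSubtype j) ≠ 0 := fun j hj => e.extendSubtype_mem j hj
  have h2 : ∀ j, ¬ (y j ≠ 0) → ¬ (x (e.extendSubtype j) ≠ 0) := fun j hj => e.extendSubtype_not_mem j hj
  refine ⟨(e.extendSubtype, ⟨fun j => if y j = 0 then 1 else y j / x (e.extendSubtype j), ?_⟩), ?_⟩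
  · intro j
    dsimp only
    split_ifs with hj
    · exact one_ne_zero
    · exact div_ne_zero hj (h1 j hj)
  · funext j
    simp only [auxPhi]
    split_ifs with hj
    · have := h2 j (by simpa using hj)
      simp only [not_not] at this
      simp [this, hj]
    · exact div_mul_cancel₀ _ (h1 j hj)

open Finset Classical in
theorem aux_M_le {ι F : Type} [Fintype ι] [DecidableEq ι] [Field F] [Fintype F] [DecidableEq F]
    (C : Set (ι → F)) (x y : ι → F) (h : hammingNorm x = hammingNorm y) :
    (univ.filter (fun t : AuxT ι F => auxPhi t y ∈ C)).card ≤
    (univ.filter (fun t : AuxT ι F => auxPhi t x ∈ C)).card := by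
  obtain ⟨t0, rfl⟩ := aux_trans x y h
  refine card_le_card_of_injOn (fun t => (t.1.trans t0.1, ⟨fun j => t.2.1 j * t0.2.1 (t.1 j),
    fun j => mul_ne_zero (t.2.2 _) (t0.2.2 _)⟩)) ?_ ?_
  · intro t ht
    simp only [coe_filter, mem_univ, true_and, Set.mem_setOf_eq] at ht ⊢
    convert ht using 1
    funext j
    simp [auxPhi, mul_assoc]
  · rintro ⟨p, c, hc⟩ _ ⟨p', c', hc'⟩ _ heq
    simp only [Prod.mk.injEq, Subtype.mk.injEq] at heq
    obtain ⟨h1, h2⟩ := heq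
    have hp : p = p' := by
      ext j
      exact t0.1.injective (by simpa using congrArg (fun f => f j) h1)
    subst hp
    have : c = c' := by
      funext j
      exact mul_right_cancel₀ (t0.2.2 _) (congrFun h2 j)
    subst this
    rfl

open Finset Classical in
theorem aux_main {ι F : Type} [Fintype ι] [DecidableEq ι] [Field F] [Fintype F] [DecidableEq F]
    (C : Set (ι → F)) (W : ℕ) :
    (∑ t : AuxT ι F × AuxT ι F, Nat.card {x : ι → F // auxPhi t.1 x ∈ C ∧ auxPhi t.2 x ∈ C ∧
      hammingNorm x = W}) * (univ.filter (fun x : ι → F => hammingNorm x = W)).card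
    = (Fintype.card (AuxT ι F) * (univ.filter (fun x : ι → F => x ∈ C ∧ hammingNorm x = W)).card) ^ 2 := by
  set S := univ.filter (fun x : ι → F => hammingNorm x = W) with hS
  let M : (ι → F) → ℕ := fun x => (univ.filter (fun t : AuxT ι F => auxPhi t x ∈ C)).card
  have hM : ∀ x ∈ S, ∀ y ∈ S, M x = M y := by
    intro x hx y hy
    simp only [hS, mem_filter, mem_univ, true_and] at hx hy
    exact le_antisymm (aux_M_le C y x (by rw [hx, hy])) (aux_M_le C x y (by rw [hx, hy]))
  have e1 : (∑ t : AuxT ι F × AuxT ι F, Nat.card {x : ι → F // auxPhi t.1 x ∈ C ∧ auxPhi t.2 x ∈ C ∧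
      hammingNorm x = W}) = ∑ x ∈ S, M x ^ 2 := by
    have : ∀ t : AuxT ι F × AuxT ι F, Nat.card {x : ι → F // auxPhi t.1 x ∈ C ∧ auxPhi t.2 x ∈ C ∧
      hammingNorm x = W} = ∑ x ∈ S, (if auxPhi t.1 x ∈ C then 1 else 0) * (if auxPhi t.2 x ∈ C then 1 else 0) := by
      intro t
      rw [Nat.card_eq_fintype_card, Fintype.card_subtype, card_filter, hS, sum_filter]
      refine sum_congr rfl fun x _ => ?_
      by_cases h1 : auxPhi t.1 x ∈ C <;> by_cases h2 : auxPhi t.2 x ∈ C <;> simp [h1, h2]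
    simp only [this]
    rw [sum_comm]
    refine sum_congr rfl fun x _ => ?_
    rw [Fintype.sum_prod_type, sq]
    simp only [M, card_filter]
    rw [sum_mul_sum]
  have e2 : ∑ x ∈ S, M x = Fintype.card (AuxT ι F) * (univ.filter (fun x : ι → F => x ∈ C ∧ hammingNorm x = W)).card := by
    simp only [M, card_filter]
    rw [sum_comm, ← smul_eq_mul, ← card_univ, ← sum_const]
    refine sum_congr rfl fun t _ => ?_
    let e : (ι → F) ≃ (ι → F) := Equiv.ofBijective (auxPhi t) (Finite.injective_iff_bijective.1 (auxPhi_inj t))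
    rw [← Equiv.sum_comp e, hS, sum_filter]
    refine sum_congr rfl fun x _ => ?_
    have : e x = auxPhi t x := rfl
    rw [this, auxPhi_wt]
    by_cases h1 : auxPhi t x ∈ C <;> simp [h1]
  rw [e1, ← e2]
  rcases S.eq_empty_or_nonempty with h | ⟨x0, hx0⟩
  · simp [h]
  · rw [sum_congr rfl (fun x hx => by rw [hM x hx x0 hx0] : ∀ x ∈ S, M x ^ 2 = M x0 ^ 2),
      sum_congr rfl (fun x hx => hM x hx x0 hx0)]
    simp only [sum_const, smul_eq_mul]
    ring

open Finset in
theorem aux_cardT {ι F : Type} [Fintype ι] [DecidableEq ι] [Field F] [Fintype F] [DecidableEq F] :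
    Fintype.card (AuxT ι F) = (Fintype.card ι).factorial * (Fintype.card F - 1) ^ (Fintype.card ι) := by
  rw [Fintype.card_prod, Fintype.card_perm]
  congr 1
  have : (univ.filter (fun c : ι → F => ∀ j, c j ≠ 0)) = Fintype.piFinset (fun _ => univ.erase (0 : F)) := by
    ext c; simp [Fintype.mem_piFinset]
  rw [Fintype.card_subtype, this, Fintype.card_piFinset]
  simp [card_erase_of_mem]

open Finset Classical in
theorem aux_gen {F : Type} [Field F] [Fintype F] [DecidableEq F] (b d : ℕ)
    (C0 : Set (Fin d → F)) (s : ℝ) :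
    (∑ᶠ y ∈ C0, s ^ hammingNorm y) ^ b =
    ∑ x ∈ univ.filter (fun x : Fin b × Fin d → F => ∀ i : Fin b, (fun j => x (i, j)) ∈ C0),
      s ^ hammingNorm x := by
  have h0 : (∑ᶠ y ∈ C0, s ^ hammingNorm y) = ∑ y ∈ univ.filter (fun y => y ∈ C0), s ^ hammingNorm y := by
    rw [← finsum_mem_coe_finset]
    simp
  have h1 : (∑ᶠ y ∈ C0, s ^ hammingNorm y) ^ b =
      ∏ _i : Fin b, ∑ y ∈ univ.filter (fun y => y ∈ C0), s ^ hammingNorm y := by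
    rw [h0]; simp
  rw [h1, prod_univ_sum]
  symm
  refine sum_bij (fun x _ => fun i j => x (i, j)) ?_ ?_ ?_ ?_
  · intro x hx
    simpa [Fintype.mem_piFinset] using hx
  · intro x _ y _ h
    funext ⟨i, j⟩
    exact congrFun (congrFun h i) j
  · intro z hz
    refine ⟨fun p => z p.1 p.2, ?_, rfl⟩
    simpa [Fintype.mem_piFinset] using hz
  · intro x _
    rw [prod_pow_eq_pow_sum]
    congr 1
    simp only [hammingNorm, card_filter]
    rw [Fintype.sum_prod_type]


/-- Let q be a prime power, let C0 = RS(Δ0,k0) be a Reed–Solomon code over F_q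
with weight enumerator g0(s) = Σ_{y∈C0} s^{wt(y)}, let b ≥ 1 and n = bΔ0, and consider the
two-layer ensemble E1(Δ0,b) with base code C_b = C0^b.  Then for every real s > 0 and every W
with 0 ≤ W ≤ n, Ā(W) ≤ (g0(s)^b · s^{−W})² / ((q−1)^W · binom(n,W)). -/
theorem statement_6 (q Δ0 k0 : ℕ) (hq : IsPrimePow q)
    (F : Type) [Field F] [Fintype F] [DecidableEq F] (hF : Fintype.card F = q)
    (hk0 : 1 ≤ k0) (hk0' : k0 ≤ Δ0) (hΔ0q : Δ0 ≤ q)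
    (α : Fin Δ0 → F) (hα : Function.Injective α)
    (C0 : Set (Fin Δ0 → F))
    (hC0 : C0 = {y | ∃ p : Polynomial F, p.degree < (k0 : ℕ) ∧ ∀ j, y j = p.eval (α j)})
    (g0 : ℝ → ℝ) (hg0 : ∀ s : ℝ, g0 s = ∑ᶠ y ∈ C0, s ^ hammingNorm y)
    (b : ℕ) (hb : 1 ≤ b) (n : ℕ) (hn : n = b * Δ0)
    (Cb : Set (Fin b × Fin Δ0 → F))
    (hCb : Cb = {x | ∀ i : Fin b, (fun j => x (i, j)) ∈ C0})
    (s : ℝ) (hs : 0 < s) (W : ℕ) (hW : W ≤ n) :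
    (∑ t : (Equiv.Perm (Fin b × Fin Δ0) × {c : Fin b × Fin Δ0 → F // ∀ j, c j ≠ 0}) ×
           (Equiv.Perm (Fin b × Fin Δ0) × {c : Fin b × Fin Δ0 → F // ∀ j, c j ≠ 0}),
        (Nat.card {x : Fin b × Fin Δ0 → F //
            (fun j => (t.1.2 : Fin b × Fin Δ0 → F) j * x (t.1.1 j)) ∈ Cb ∧
            (fun j => (t.2.2 : Fin b × Fin Δ0 → F) j * x (t.2.1 j)) ∈ Cb ∧
            hammingNorm x = W} : ℝ))
      / ((n.factorial : ℝ) * ((q : ℝ) - 1) ^ n) ^ 2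
    ≤ (g0 s ^ b * s ^ (-(W : ℤ))) ^ 2 / (((q : ℝ) - 1) ^ W * (n.choose W : ℝ)) := by
  classical
  have hq2 : 2 ≤ q := hq.two_le
  have hq1 : ((q - 1 : ℕ) : ℝ) = (q : ℝ) - 1 := by
    rw [Nat.cast_sub (by omega)]; simp
  have hqpos : (0 : ℝ) < (q : ℝ) - 1 := by
    rw [← hq1]; exact_mod_cast (by omega : 0 < q - 1)
  have hι : Fintype.card (Fin b × Fin Δ0) = n := by simp [hn]
  have key := aux_main (F := F) Cb W
  rw [aux_sphere, aux_cardT, hι, hF] at key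
  set A : ℕ := (Finset.univ.filter (fun x : Fin b × Fin Δ0 → F => x ∈ Cb ∧ hammingNorm x = W)).card with hA
  have keyR := congrArg (Nat.cast : ℕ → ℝ) key
  push_cast at keyR
  rw [hq1] at keyR
  have hgen : (A : ℝ) ≤ g0 s ^ b * s ^ (-(W : ℤ)) := by
    rw [zpow_neg, zpow_natCast, ← div_eq_mul_inv, le_div_iff₀ (pow_pos hs W), hg0, aux_gen]
    have : (A : ℝ) * s ^ W = ∑ x ∈ Finset.univ.filter
        (fun x : Fin b × Fin Δ0 → F => x ∈ Cb ∧ hammingNorm x = W), s ^ hammingNorm x := by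
      rw [Finset.sum_congr rfl (g := fun _ => s ^ W)]
      · simp [hA]
      · intro x hx
        rw [(Finset.mem_filter.1 hx).2.2]
    rw [this]
    refine Finset.sum_le_sum_of_subset_of_nonneg ?_ (fun x _ _ => (pow_pos hs _).le)
    intro x hx
    simp only [Finset.mem_filter, Finset.mem_univ, true_and, hCb, Set.mem_setOf_eq] at hx ⊢
    exact hx.1
  have hch : (0 : ℝ) < (n.choose W : ℝ) := by exact_mod_cast Nat.choose_pos hW
  have hden : (0 : ℝ) < ((q : ℝ) - 1) ^ W * (n.choose W : ℝ) := mul_pos (pow_pos hqpos _) hch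
  have hT : (0 : ℝ) < ((n.factorial : ℝ) * ((q : ℝ) - 1) ^ n) ^ 2 :=
    pow_pos (mul_pos (by exact_mod_cast n.factorial_pos) (pow_pos hqpos _)) _
  have hsq : (A : ℝ) ^ 2 ≤ (g0 s ^ b * s ^ (-(W : ℤ))) ^ 2 :=
    pow_le_pow_left₀ (Nat.cast_nonneg _) hgen 2
  rw [div_le_div_iff₀ hT hden]
  refine le_trans (le_of_eq ?_) (mul_le_mul_of_nonneg_right hsq hT.le)
  rw [mul_comm (((q : ℝ) - 1) ^ W)]
  refine Eq.trans keyR ?_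
  ring
end
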